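/- arXiv:2601.10901 — 4 statements merged into one kernel-verified Lean document; each statement's English description precedes it below -/
import Mathlib

section
/- Let U be a finite type and f : Finset U → ℝ be monotone and submodular. Then for any two sets O, G ⊆ U, f(O) ≤ f(G) + Σ_{v ∈ O \ G} f({v} | G). -/
/-- A set function is submodular if
`f (A ∪ {e}) - f A ≥ f (B ∪ {e}) - f B` for all `A ⊆ B` and `e ∉ B`. -/
def IsSubmodular {U : Type*} [DecidableEq U] (f : Finset U → ℝ) : Prop :=
  ∀ A B : Finset U, A ⊆ B → ∀ e ∉ B, f (insert e A) - f A ≥ f (insert e B) - f B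

/-- A set function is monotone if `f A ≤ f B` whenever `A ⊆ B`. -/
def IsMonotoneFn {U : Type*} [DecidableEq U] (f : Finset U → ℝ) : Prop :=
  ∀ A B : Finset U, A ⊆ B → f A ≤ f B

/-- The marginal gain `f(A | B) = f (A ∪ B) - f B`. -/
def marg {U : Type*} [DecidableEq U] (f : Finset U → ℝ) (A B : Finset U) : ℝ :=
  f (A ∪ B) - f B

/-- The total gain of adding a set disjoint from `G` is at most the sum of the marginal gains. -/
theorem IsSubmodular.union_le_add_sum_marg {U : Type*} [DecidableEq U] {f : Finset U → ℝ}
    (hsub : IsSubmodular f) (G S : Finset U) (hS : Disjoint S G) :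
    f (S ∪ G) ≤ f G + ∑ v ∈ S, marg f {v} G := by
  induction S using Finset.induction_on with
  | empty => simp
  | insert e S he ih =>
    rw [Finset.disjoint_insert_left] at hS
    have hgain := hsub G (S ∪ G) Finset.subset_union_right e (by simp [he, hS.1])
    have hle := ih hS.2
    rw [Finset.sum_insert he, Finset.insert_union, marg, Finset.singleton_union]
    linarith

/-- For monotone submodular `f` and any sets `O, G`,
`f O ≤ f G + ∑_{v ∈ O \ G} f({v} | G)`. -/
theorem submodular_upper_bound {U : Type*} [Fintype U] [DecidableEq U]
    (f : Finset U → ℝ) (hmono : IsMonotoneFn f) (hsub : IsSubmodular f)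
    (O G : Finset U) :
    f O ≤ f G + ∑ v ∈ O \ G, marg f {v} G := by
  calc f O ≤ f (O \ G ∪ G) := hmono _ _ (by simp)
    _ ≤ f G + ∑ v ∈ O \ G, marg f {v} G :=
      hsub.union_le_add_sum_marg G (O \ G) Finset.sdiff_disjoint
end

section
/- Let U be a finite type and f : Finset U → ℝ be monotone and submodular. Let B ⊆ U, let P ⊆ U be a pool, and let g_1, …, g_k be distinct elements of P chosen greedily in this order, meaning that for every l ∈ {1, …, k} and every v ∈ P, f({g_l} | B ∪ {g_1, …, g_{l−1}}) ≥ f({v} | B ∪ {g_1, …, g_{l−1}}). Let G = {g_1, …, g_k}. Then for any elements O_1, …, O_k ∈ P, Σ_{l=1}^k f({O_l} | B ∪ G) ≤ f(B ∪ G) − f(B). -/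
/-- For a monotone submodular function, the marginal gain of a single element is antitone
in the base set. -/
theorem marg_singleton_anti {U : Type*} [DecidableEq U] {f : Finset U → ℝ}
    (hmono : IsMonotoneFn f) (hsub : IsSubmodular f) {A B : Finset U} (hAB : A ⊆ B) (e : U) :
    marg f {e} B ≤ marg f {e} A := by
  simp only [marg, Finset.singleton_union]
  by_cases he : e ∈ B
  · rw [Finset.insert_eq_of_mem he, sub_self]
    exact sub_nonneg.2 (hmono _ _ (Finset.subset_insert e A))
  · exact hsub A B hAB e he

/-- The marginal gains of successively added elements telescope. -/
theorem sum_marg_prefix {U : Type*} [DecidableEq U] (f : Finset U → ℝ) (B : Finset U) {k : ℕ}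
    (g : Fin k → U) :
    ∑ l : Fin k, marg f {g l} (B ∪ (Finset.univ.filter (fun m : Fin k => m < l)).image g)
      = f (B ∪ Finset.univ.image g) - f B := by
  let F : ℕ → ℝ := fun n =>
    f (B ∪ (Finset.univ.filter (fun m : Fin k => (m : ℕ) < n)).image g)
  have hstep (l : Fin k) :
      marg f {g l} (B ∪ (Finset.univ.filter (fun m : Fin k => m < l)).image g)
        = F (l + 1) - F l := by
    have hset : {g l} ∪ (B ∪ (Finset.univ.filter (fun m : Fin k => m < l)).image g)
        = B ∪ (Finset.univ.filter (fun m : Fin k => (m : ℕ) < l + 1)).image g := by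
      have hfilter : Finset.univ.filter (fun m : Fin k => (m : ℕ) < l + 1)
          = insert l (Finset.univ.filter (fun m : Fin k => m < l)) := by
        ext m
        simp only [Finset.mem_filter, Finset.mem_univ, true_and, Finset.mem_insert,
          Fin.ext_iff, Fin.lt_def]
        omega
      rw [hfilter, Finset.image_insert, Finset.singleton_union, Finset.union_insert]
    rw [marg, hset]
    simp only [F, Fin.lt_def]
  rw [Finset.sum_congr rfl fun l _ => hstep l,
    Fin.sum_univ_eq_sum_range (fun n => F (n + 1) - F n) k, Finset.sum_range_sub]
  simp [F]

/-- Let `g 0, …, g (k-1)` be distinct elements of a pool `P`,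
chosen greedily in order on top of a base set `B` (each `g l` maximizes, over
`v ∈ P`, the marginal gain with respect to `B ∪ {g 0, …, g (l-1)}`).
Let `G` be the set of chosen elements. Then for any elements `O_0, …, O_{k-1} ∈ P`,
`∑ l, f({O l} | B ∪ G) ≤ f (B ∪ G) - f B`. -/
theorem greedy_marginal_bound {U : Type*} [Fintype U] [DecidableEq U]
    (f : Finset U → ℝ) (hmono : IsMonotoneFn f) (hsub : IsSubmodular f)
    (B P : Finset U) (k : ℕ) (g : Fin k → U)
    (hginj : Function.Injective g) (hgP : ∀ l, g l ∈ P)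
    (hgreedy : ∀ l : Fin k, ∀ v ∈ P,
      marg f {g l} (B ∪ (Finset.univ.filter (fun m : Fin k => m < l)).image g)
        ≥ marg f {v} (B ∪ (Finset.univ.filter (fun m : Fin k => m < l)).image g))
    (O : Fin k → U) (hO : ∀ l, O l ∈ P) :
    ∑ l : Fin k, marg f {O l} (B ∪ Finset.univ.image g)
      ≤ f (B ∪ Finset.univ.image g) - f B := by
  rw [← sum_marg_prefix f B g]
  refine Finset.sum_le_sum fun l _ => ?_
  exact (marg_singleton_anti hmono hsub (Finset.union_subset_union_right
    (Finset.image_subset_image (Finset.filter_subset _ _))) (O l)).trans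
      (hgreedy l (O l) (hO l))
end

section
/- Best-of-m selection lemma: Let U be a finite type and f : Finset U → ℝ be nonnegative, monotone and submodular. Let B ⊆ U and let C_1, …, C_m ⊆ U be sets (m ≥ 1). If j* ∈ {1, …, m} satisfies f(C_{j*} | B) ≥ f(C_j | B) for all j ∈ {1, …, m}, then f(B ∪ C_{j*}) ≥ (1/m) · f(B ∪ C_1 ∪ ⋯ ∪ C_m). -/
/-- For a monotone submodular function, the marginal gain of a set decreases in the base set. -/
theorem IsSubmodular.marg_anti {U : Type*} [DecidableEq U] {f : Finset U → ℝ}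
    (hsub : IsSubmodular f) (hmono : IsMonotoneFn f) {A B : Finset U} (hAB : A ⊆ B)
    (S : Finset U) : marg f S B ≤ marg f S A := by
  unfold marg
  induction S using Finset.induction_on with
  | empty => simp
  | insert e S _ ih =>
    rw [Finset.insert_union, Finset.insert_union]
    by_cases he : e ∈ S ∪ B
    · rw [Finset.insert_eq_of_mem he]
      linarith [hmono _ _ (Finset.subset_insert e (S ∪ A))]
    · linarith [hsub _ _ (Finset.union_subset_union_right (s := S) hAB) e he]

/-- For a monotone submodular function, the marginal gain of a union is at most the sum of the
marginal gains. -/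
theorem IsSubmodular.marg_biUnion_le_sum {U ι : Type*} [DecidableEq U] {f : Finset U → ℝ}
    (hsub : IsSubmodular f) (hmono : IsMonotoneFn f) (B : Finset U) (C : ι → Finset U)
    (s : Finset ι) : marg f (s.biUnion C) B ≤ ∑ j ∈ s, marg f (C j) B := by
  classical
  induction s using Finset.induction_on with
  | empty => simp [marg]
  | insert i s hi ih =>
    rw [Finset.sum_insert hi, Finset.biUnion_insert]
    have h := hsub.marg_anti hmono (Finset.subset_union_right (s₁ := s.biUnion C) (s₂ := B)) (C i)
    unfold marg at *
    rw [Finset.union_assoc]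
    linarith

/-- Best-of-m selection lemma. If `C j*` maximizes the marginal
gain over `B` among `C_1, …, C_m` (`m ≥ 1`), then
`f (B ∪ C j*) ≥ (1/m) * f (B ∪ C_1 ∪ ⋯ ∪ C_m)`. -/
theorem best_of_m_selection {U : Type*} [Fintype U] [DecidableEq U]
    (f : Finset U → ℝ) (hnonneg : ∀ A : Finset U, 0 ≤ f A)
    (hmono : IsMonotoneFn f) (hsub : IsSubmodular f)
    (m : ℕ) (hm : 1 ≤ m) (B : Finset U) (C : Fin m → Finset U)
    (jstar : Fin m) (hbest : ∀ j : Fin m, marg f (C jstar) B ≥ marg f (C j) B) :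
    f (B ∪ C jstar) ≥ (1 / (m : ℝ)) * f (B ∪ Finset.univ.biUnion C) := by
  have hsum := (hsub.marg_biUnion_le_sum hmono B C Finset.univ).trans
    (Finset.sum_le_card_nsmul _ _ _ fun j _ => hbest j)
  simp only [marg, Finset.card_univ, Fintype.card_fin, nsmul_eq_mul, Finset.union_comm _ B]
    at hsum
  have hm' : (1 : ℝ) ≤ m := by exact_mod_cast hm
  rw [ge_iff_le, one_div_mul_eq_div, div_le_iff₀ (by linarith)]
  nlinarith [mul_nonneg (sub_nonneg.2 hm') (hnonneg B)]
end

section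
/- Competitive ratio of STORM++ (Theorem 3, core inequality): Let U be a finite type, f : Finset U → ℝ be nonnegative, monotone and submodular, T ≥ 1, δ ≥ 1 a positive integer, and P^1, …, P^T, G^1, …, G^T ⊆ U be sets such that for every t ∈ {1, …, T}, f(P^t | ⋃_{s<t} P^s) ≥ f(G^t | ⋃_{s<t} P^s). If O ⊆ U is a set with f(⋃_{t=1}^T G^t) ≥ (1/(4δ)) · f(O), then f(⋃_{t=1}^T P^t) ≥ (1/(8δ)) · f(O). -/
/-- The union of the first `n` sets of the family `X` (empty for `n = 0`). -/
def prefUnion {U : Type*} [DecidableEq U] {T : ℕ} (X : Fin T → Finset U) (n : ℕ) :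
    Finset U :=
  (Finset.univ.filter (fun s : Fin T => (s : ℕ) < n)).biUnion X

@[simp]
theorem prefUnion_zero {U : Type*} [DecidableEq U] {T : ℕ} (X : Fin T → Finset U) :
    prefUnion X 0 = ∅ := by
  simp [prefUnion]

theorem prefUnion_self {U : Type*} [DecidableEq U] {T : ℕ} (X : Fin T → Finset U) :
    prefUnion X T = Finset.univ.biUnion X := by
  simp [prefUnion]

theorem prefUnion_succ {U : Type*} [DecidableEq U] {T : ℕ} (X : Fin T → Finset U) (t : Fin T) :
    prefUnion X (t + 1) = X t ∪ prefUnion X t := by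
  have : Finset.univ.filter (fun s : Fin T => (s : ℕ) < t + 1) =
      insert t (Finset.univ.filter (fun s : Fin T => (s : ℕ) < t)) := by
    ext s
    simp only [Finset.mem_filter, Finset.mem_univ, true_and, Finset.mem_insert, Fin.ext_iff]
    omega
  rw [prefUnion, this, Finset.biUnion_insert, prefUnion]

theorem prefUnion_subset {U : Type*} [DecidableEq U] {T : ℕ} (X : Fin T → Finset U) (n : ℕ) :
    prefUnion X n ⊆ Finset.univ.biUnion X :=
  Finset.biUnion_subset_biUnion_of_subset_left _ (Finset.filter_subset _ _)

/-- If each `P t` gains at least as much as `G t` over the preceding `P s`, then the first `n` sets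
`G t` gain at most `f (prefUnion P n) - f ∅` over the union of all the `P t`. -/
theorem marg_prefUnion_le {U : Type*} [DecidableEq U] {f : Finset U → ℝ}
    (hmono : IsMonotoneFn f) (hsub : IsSubmodular f) {T : ℕ} {P G : Fin T → Finset U}
    (hsel : ∀ t : Fin T, marg f (G t) (prefUnion P t) ≤ marg f (P t) (prefUnion P t))
    {n : ℕ} (hn : n ≤ T) :
    marg f (prefUnion G n) (Finset.univ.biUnion P) ≤ f (prefUnion P n) - f ∅ := by
  induction n with
  | zero => simp [marg]
  | succ n ih =>
    have hG := prefUnion_succ G ⟨n, hn⟩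
    have hP := prefUnion_succ P ⟨n, hn⟩
    have hs := hsel ⟨n, hn⟩
    have ha := hsub.marg_anti hmono
      ((prefUnion_subset P n).trans
        (Finset.subset_union_right (s₁ := prefUnion G n))) (G ⟨n, hn⟩)
    have ih := ih (by omega)
    simp only at hG hP hs
    rw [hG, hP]
    simp only [marg, Finset.union_assoc] at *
    linarith

/-- Competitive ratio of STORM++ (Theorem 3, core inequality).
If at each step `t` the marginal gain of `P^t` over `⋃_{s<t} P^s` is at least
that of `G^t`, and `f(⋃ G^t) ≥ (1/(4δ)) * f O`, then
`f(⋃ P^t) ≥ (1/(8δ)) * f O`. -/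
theorem storm_pp_competitive_ratio {U : Type*} [Fintype U] [DecidableEq U]
    (f : Finset U → ℝ) (hnonneg : ∀ A : Finset U, 0 ≤ f A)
    (hmono : IsMonotoneFn f) (hsub : IsSubmodular f)
    (T : ℕ) (hT : 1 ≤ T) (δ : ℕ) (hδ : 1 ≤ δ)
    (P G : Fin T → Finset U)
    (hsel : ∀ t : Fin T,
      marg f (P t) (prefUnion P (t : ℕ)) ≥ marg f (G t) (prefUnion P (t : ℕ)))
    (O : Finset U)
    (hO : f (Finset.univ.biUnion G) ≥ (1 / (4 * (δ : ℝ))) * f O) :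
    f (Finset.univ.biUnion P) ≥ (1 / (8 * (δ : ℝ))) * f O := by
  have hgain := marg_prefUnion_le hmono hsub hsel le_rfl
  rw [prefUnion_self, prefUnion_self, marg] at hgain
  have hG := hmono _ _ (Finset.subset_union_left
    (s₁ := Finset.univ.biUnion G) (s₂ := Finset.univ.biUnion P))
  have h0 := hnonneg ∅
  have hhalf : 1 / (8 * (δ : ℝ)) * f O = 1 / (4 * (δ : ℝ)) * f O / 2 := by
    ring
  linarith
end
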